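/- For every finite sequence ν of signs of length n ≥ 2 whose first entry is + and whose second entry is −, there exists a binary tree t with n leaves such that σ(t, +) = ν. (This is the fact, used in the proof that the oriented Thompson group is isomorphic to the group of reduced (ν,ν)-strand diagrams, that every n-sign is induced by some tree.) -/

import Mathlib

/-- A planar rooted binary tree. -/
inductive BinTree : Type
  | leaf : BinTree
  | node : BinTree → BinTree → BinTree
deriving DecidableEq

/-- The number of leaves of a binary tree. -/
def BinTree.numLeaves : BinTree → ℕ
  | .leaf => 1
  | .node l r => l.numLeaves + r.numLeaves

/-- The sign sequence induced at the leaves of a binary tree whose leftmost region carries the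
sign `s` (signs are booleans, `true` = `+`, `false` = `−`, and `!s` is the opposite sign):
`σ(leaf, s) = [s]` and `σ(node l r, s) = σ(l, s) ++ σ(r, −s)`. -/
def signSeq : BinTree → Bool → List Bool
  | .leaf, s => [s]
  | .node l r, s => signSeq l s ++ signSeq r (!s)

/-- The doubling operation on sign sequences: each entry `s` is replaced by the two
consecutive entries `s`, `−s`. -/
def doubling (L : List Bool) : List Bool := (L.map fun s => [s, !s]).flatten

/-- The blowup of a binary tree: attach a caret at every leaf. -/
def blowup : BinTree → BinTree
  | .leaf => .node .leaf .leaf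
  | .node l r => .node (blowup l) (blowup r)

/-- The complete (symmetric) binary tree `S_k`. -/
def symTree : ℕ → BinTree
  | 0 => .leaf
  | k + 1 => .node (symTree k) (symTree k)

theorem numLeaves_eq_length (t : BinTree) : ∀ s, t.numLeaves = (signSeq t s).length := by
  induction t with
  | leaf => intro s; rfl
  | node l r ihl ihr =>
    intro s
    simp only [BinTree.numLeaves, signSeq, List.length_append]
    rw [← ihl s, ← ihr (!s)]

/-- Attaching a caret at the leftmost leaf. -/
theorem exists_graft (t : BinTree) (s : Bool) :
    ∃ L t', signSeq t s = s :: L ∧ signSeq t' s = s :: (!s) :: L := by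
  induction t with
  | leaf => exact ⟨[], .node .leaf .leaf, rfl, rfl⟩
  | node l r ihl _ =>
    obtain ⟨L, t', h, h'⟩ := ihl
    exact ⟨L ++ signSeq r (!s), .node t' r, by simp [signSeq, h], by simp [signSeq, h']⟩

theorem exists_tree_aux (w : List Bool) : ∀ s, ∃ t, signSeq t s = s :: (!s) :: w := by
  induction w with
  | nil => intro s; exact ⟨.node .leaf .leaf, rfl⟩
  | cons x w ih =>
    intro s
    by_cases hx : x = s
    · subst hx
      obtain ⟨t, ht⟩ := ih (!x)
      exact ⟨.node .leaf t, by simp [signSeq, ht]⟩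
    · have hx' : x = !s := by cases x <;> cases s <;> simp_all
      subst hx'
      obtain ⟨t, ht⟩ := ih s
      obtain ⟨L, t', h, h'⟩ := exists_graft t s
      rw [ht] at h
      injection h with _ h
      exact ⟨t', by rw [h', ← h]⟩

/-- Every `n`-sign — a sequence of `n ≥ 2` signs starting with `+`, `−` (`true`, `false`) — is
induced by some binary tree with `n` leaves, positively oriented. -/
theorem exists_tree_of_nSign (ν : List Bool) (hlen : 2 ≤ ν.length)
    (h0 : ν[0]! = true) (h1 : ν[1]! = false) :
    ∃ t : BinTree, t.numLeaves = ν.length ∧ signSeq t true = ν := by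
  match ν, hlen, h0, h1 with
  | a :: b :: w, _, h0, h1 =>
    have ha : a = true := by simpa using h0
    have hb : b = false := by simpa using h1
    subst ha hb
    obtain ⟨t, ht⟩ := exists_tree_aux w true
    refine ⟨t, ?_, ht⟩
    rw [numLeaves_eq_length t true, ht]
    rfl
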